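/- Let F₀ be a number field and σ : F₀ → F₀ a ℚ-algebra automorphism with σ ≠ id such that ρ(σ(a)) = conj(ρ(a)) for every ring embedding ρ : F₀ → ℂ. Let V be a finite-dimensional F₀-vector space and W ⊆ V_ℂ a ℂ-subspace stable under a ⊗ 1 for every a ∈ F₀, such that V_ℂ = W ⊕ c(W), and such that for every embedding τ : F₀ → ℂ, at least one of W ∩ V_τ = 0 or W ∩ V_{τ∘σ} = 0 holds. Then W is the (internal direct) sum of those eigenspaces V_τ it contains, i.e. W = Σ_{τ : V_τ ⊆ W} V_τ, and consequently every F₀-linear map g : V → V satisfies (g ⊗ id_ℂ)(W) ⊆ W. -/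

import Mathlib

open TensorProduct

/-- Complex conjugation `c = id_V ⊗ conj` on `V_ℂ = ℂ ⊗[ℚ] V`. -/
noncomputable def conjC (V : Type*) [AddCommGroup V] [Module ℚ V] :
    (ℂ ⊗[ℚ] V) →ₗ[ℚ] (ℂ ⊗[ℚ] V) :=
  LinearMap.rTensor V ((Complex.conjAe.toLinearMap).restrictScalars ℚ)

/-- The action of `a ∈ K` on `ℂ ⊗[ℚ] V`, i.e. `a ⊗ 1`. -/
noncomputable def actionC (K V : Type*) [Field K] [Algebra ℚ K] [AddCommGroup V]
    [Module ℚ V] [Module K V] [IsScalarTower ℚ K V] (a : K) :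
    (ℂ ⊗[ℚ] V) →ₗ[ℂ] (ℂ ⊗[ℚ] V) :=
  LinearMap.baseChange ℂ ((LinearMap.lsmul K V a).restrictScalars ℚ)

/-- The eigenspace `V_τ` attached to an embedding `τ : K → ℂ`. -/
noncomputable def eigenspaceC (K V : Type*) [Field K] [Algebra ℚ K] [AddCommGroup V]
    [Module ℚ V] [Module K V] [IsScalarTower ℚ K V] (τ : K →+* ℂ) :
    Submodule ℂ (ℂ ⊗[ℚ] V) where
  carrier := {v | ∀ a : K, actionC K V a v = τ a • v}
  add_mem' := by
    intro x y hx hy a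
    simp [map_add, hx a, hy a, smul_add]
  zero_mem' := by
    intro a
    simp
  smul_mem' := by
    intro z v hv a
    rw [map_smul, hv a, smul_comm]

section

open Polynomial

/-- The action of `K` on `ℂ ⊗[ℚ] V` as an algebra homomorphism. -/
noncomputable def actionCHom (K V : Type*) [Field K] [Algebra ℚ K] [AddCommGroup V]
    [Module ℚ V] [Module K V] [IsScalarTower ℚ K V] :
    K →ₐ[ℚ] Module.End ℂ (ℂ ⊗[ℚ] V) :=
  AlgHom.ofLinearMap
    { toFun := actionC K V
      map_add' := fun a b => by
        ext v
        simp [actionC]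
      map_smul' := fun q a => by
        ext v
        simp [actionC] }
    (by ext v; simp [actionC])
    (fun a b => by ext v; simpa [actionC, mul_smul] using congrArg _ (smul_comm a b v))

section

variable {K V : Type*} [Field K] [Algebra ℚ K] [AddCommGroup V]
  [Module ℚ V] [Module K V] [IsScalarTower ℚ K V]

@[simp]
lemma actionCHom_apply (a : K) : actionCHom K V a = actionC K V a := rfl

lemma mem_eigenspaceC {τ : K →+* ℂ} {v : ℂ ⊗[ℚ] V} :
    v ∈ eigenspaceC K V τ ↔ ∀ a : K, actionC K V a v = τ a • v := Iff.rfl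

lemma actionC_conjC (a : K) (v : ℂ ⊗[ℚ] V) :
    actionC K V a (conjC V v) = conjC V (actionC K V a v) := by
  induction v with
  | zero => simp
  | tmul z v => simp [actionC, conjC]
  | add x y hx hy => simp only [map_add, hx, hy]

lemma conjC_smul (z : ℂ) (v : ℂ ⊗[ℚ] V) :
    conjC V (z • v) = (starRingEnd ℂ) z • conjC V v := by
  induction v with
  | zero => simp
  | tmul y v => simp [conjC, smul_tmul']
  | add x y hx hy => simp only [map_add, smul_add, hx, hy]

lemma conjC_mem_eigenspaceC {τ τ' : K →+* ℂ} (h : ∀ a, τ' a = (starRingEnd ℂ) (τ a))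
    {v : ℂ ⊗[ℚ] V} (hv : v ∈ eigenspaceC K V τ) : conjC V v ∈ eigenspaceC K V τ' := by
  intro a
  rw [actionC_conjC, hv a, conjC_smul, h]

lemma baseChange_mem_eigenspaceC (g : V →ₗ[K] V) {τ : K →+* ℂ}
    {v : ℂ ⊗[ℚ] V} (hv : v ∈ eigenspaceC K V τ) :
    (g.restrictScalars ℚ).baseChange ℂ v ∈ eigenspaceC K V τ := by
  intro a
  have h : actionC K V a ∘ₗ (g.restrictScalars ℚ).baseChange ℂ =
      (g.restrictScalars ℚ).baseChange ℂ ∘ₗ actionC K V a := by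
    ext v
    simp [actionC]
  have h' := LinearMap.congr_fun h v
  simp only [LinearMap.comp_apply] at h'
  rw [h', hv a, map_smul]

lemma mem_eigenspaceC_of_powerBasis (pb : PowerBasis ℚ K) {τ : K →+* ℂ} {v : ℂ ⊗[ℚ] V}
    (hv : actionC K V pb.gen v = τ pb.gen • v) : v ∈ eigenspaceC K V τ := by
  intro a
  obtain ⟨q, rfl⟩ := pb.exists_eq_aeval' a
  rw [← actionCHom_apply, ← aeval_algHom_apply]
  induction q using Polynomial.induction_on' with
  | add p q hp hq => simp only [map_add, LinearMap.add_apply, hp, hq, add_smul]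
  | monomial n c =>
    have hpow : ((actionCHom K V pb.gen) ^ n) v = (τ pb.gen) ^ n • v := by
      induction n with
      | zero => simp
      | succ n ih => rw [pow_succ', Module.End.mul_apply, ih, map_smul, actionCHom_apply, hv,
          smul_smul, pow_succ]
    have hc : τ (algebraMap ℚ K c) = (c : ℂ) := by
      rw [eq_ratCast (algebraMap ℚ K) c, map_ratCast]
    simp only [aeval_monomial, Module.End.mul_apply, hpow, map_mul, map_pow, hc,
      Module.algebraMap_end_apply, mul_smul]
    rw [← algebraMap_smul ℂ c, eq_ratCast (algebraMap ℚ ℂ) c]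

lemma aeval_mem_of_stable {A : Module.End ℂ (ℂ ⊗[ℚ] V)} {W : Submodule ℂ (ℂ ⊗[ℚ] V)}
    (hA : ∀ w ∈ W, A w ∈ W) (p : ℂ[X]) {w : ℂ ⊗[ℚ] V} (hw : w ∈ W) : aeval A p w ∈ W := by
  induction p using Polynomial.induction_on' with
  | add p q hp hq => simpa only [map_add, LinearMap.add_apply] using W.add_mem hp hq
  | monomial n c =>
    rw [aeval_monomial, Module.End.mul_apply, Module.algebraMap_end_apply]
    refine W.smul_mem c ?_
    induction n with
    | zero => simpa using hw
    | succ n ih => rw [pow_succ', Module.End.mul_apply]; exact hA _ ih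

end

section

variable {K : Type*} [Field K] [NumberField K]

lemma PowerBasis.injective_embedding_gen (pb : PowerBasis ℚ K) :
    Function.Injective fun τ : K →+* ℂ => τ pb.gen := by
  intro τ τ' h
  have : τ.toRatAlgHom = τ'.toRatAlgHom := pb.algHom_ext h
  ext a
  exact DFunLike.congr_fun this a

lemma PowerBasis.nodal_embeddings_eq_map_minpoly (pb : PowerBasis ℚ K) :
    Lagrange.nodal Finset.univ (fun τ : K →+* ℂ => τ pb.gen) =
      (minpoly ℚ pb.gen).map (algebraMap ℚ ℂ) := by
  have hgen := pb.isIntegral_gen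
  refine eq_of_monic_of_associated (Lagrange.nodal_monic) ((minpoly.monic hgen).map _) ?_
  refine associated_of_dvd_of_natDegree_le ?_ ((minpoly.monic hgen).map _).ne_zero ?_
  · refine Finset.prod_dvd_of_coprime ?_ ?_
    · exact (pairwise_coprime_X_sub_C pb.injective_embedding_gen).set_pairwise _
    · intro τ _
      rw [dvd_iff_isRoot, IsRoot, eval_map_algebraMap]
      have := aeval_algHom_apply τ.toRatAlgHom pb.gen (minpoly ℚ pb.gen)
      rw [minpoly.aeval, map_zero] at this
      exact this
  · rw [natDegree_map, Lagrange.natDegree_nodal, Finset.card_univ, NumberField.Embeddings.card,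
      pb.finrank, pb.natDegree_minpoly]

end

/-- The Lagrange projectors onto the eigenspaces. -/
lemma exists_eigenspaceC_projectors (K V : Type*) [Field K] [NumberField K] [AddCommGroup V]
    [Module ℚ V] [Module K V] [IsScalarTower ℚ K V] :
    ∃ P : (K →+* ℂ) → Module.End ℂ (ℂ ⊗[ℚ] V),
      (∑ τ, P τ = 1) ∧ (∀ τ v, P τ v ∈ eigenspaceC K V τ) ∧
      (∀ τ ρ, τ ≠ ρ → ∀ v ∈ eigenspaceC K V ρ, P τ v = 0) ∧
      (∀ W : Submodule ℂ (ℂ ⊗[ℚ] V), (∀ a : K, ∀ w ∈ W, actionC K V a w ∈ W) →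
        ∀ τ, ∀ w ∈ W, P τ w ∈ W) := by
  classical
  let pb := Field.powerBasisOfFiniteOfSeparable ℚ K
  let x : (K →+* ℂ) → ℂ := fun τ => τ pb.gen
  have hx : Function.Injective x := pb.injective_embedding_gen
  have hnodal : aeval (actionC K V pb.gen) (Lagrange.nodal Finset.univ x) = 0 := by
    rw [pb.nodal_embeddings_eq_map_minpoly, aeval_map_algebraMap, ← actionCHom_apply,
      aeval_algHom_apply, minpoly.aeval, map_zero]
  have hsum : ∑ τ, aeval (actionC K V pb.gen) (Lagrange.basis Finset.univ x τ) = 1 := by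
    rw [← map_sum, Lagrange.sum_basis hx.injOn Finset.univ_nonempty, map_one]
  have hmem : ∀ τ v, aeval (actionC K V pb.gen) (Lagrange.basis Finset.univ x τ) v ∈
      eigenspaceC K V τ := by
    intro τ v
    apply mem_eigenspaceC_of_powerBasis pb
    have hdvd : Lagrange.nodal Finset.univ x ∣
        (X - C (x τ)) * Lagrange.basis Finset.univ x τ := by
      rw [Lagrange.basis_eq_prod_sub_inv_mul_nodal_div (Finset.mem_univ τ),
        Lagrange.nodal_eq_mul_nodal_erase (Finset.mem_univ τ),
        mul_div_cancel_left₀ _ (X_sub_C_ne_zero _)]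
      exact ⟨C (Lagrange.nodalWeight Finset.univ x τ), by ring⟩
    obtain ⟨q, hq⟩ := hdvd
    have h := congrArg (fun p => aeval (actionC K V pb.gen) p v) hq
    simp only [map_mul, hnodal, zero_mul, LinearMap.zero_apply, map_sub, aeval_X, aeval_C,
      Module.End.mul_apply, LinearMap.sub_apply, Module.algebraMap_end_apply] at h
    exact sub_eq_zero.mp h
  refine ⟨fun τ => aeval (actionC K V pb.gen) (Lagrange.basis Finset.univ x τ), hsum, hmem, ?_,
    fun W hW τ w hw => aeval_mem_of_stable (hW pb.gen) _ hw⟩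
  intro τ ρ hne v hv
  have h₁ : actionC K V pb.gen (aeval (actionC K V pb.gen) (Lagrange.basis Finset.univ x τ) v) =
      x ρ • aeval (actionC K V pb.gen) (Lagrange.basis Finset.univ x τ) v :=
    aeval_mem_of_stable (W := Module.End.eigenspace (actionC K V pb.gen) (x ρ))
      (fun w hw => by
        rw [Module.End.mem_eigenspace_iff] at hw ⊢
        rw [hw, map_smul, hw]) _ (Module.End.mem_eigenspace_iff.mpr (hv pb.gen)) |>
      Module.End.mem_eigenspace_iff.mp
  rw [hmem τ v pb.gen] at h₁
  have h₂ := sub_eq_zero.mpr h₁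
  rw [← sub_smul] at h₂
  exact (smul_eq_zero.mp h₂).resolve_left (sub_ne_zero.mpr fun h => hne (hx h))

end

/-- In the exceptional case `(c')`, when for every embedding `τ` either
`W ∩ V_τ = 0` or `W ∩ V_{τ∘σ} = 0`, the subspace `W` is the sum of the eigenspaces it
contains, and hence every `F₀`-linear endomorphism of `V` preserves `W`. -/
theorem cm_type_eigenspace_decomposition
    (F₀ : Type*) [Field F₀] [NumberField F₀]
    (σ : F₀ ≃ₐ[ℚ] F₀) (hσne : σ ≠ AlgEquiv.refl)
    (hσ : ∀ (ρ : F₀ →+* ℂ) (a : F₀), ρ (σ a) = (starRingEnd ℂ) (ρ a))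
    (V : Type*) [AddCommGroup V] [Module ℚ V] [Module F₀ V] [IsScalarTower ℚ F₀ V]
    [FiniteDimensional F₀ V]
    (W : Submodule ℂ (ℂ ⊗[ℚ] V))
    (hstable : ∀ (a : F₀), ∀ w ∈ W, actionC F₀ V a w ∈ W)
    (hinf : W.restrictScalars ℚ ⊓ Submodule.map (conjC V) (W.restrictScalars ℚ) = ⊥)
    (hsup : W.restrictScalars ℚ ⊔ Submodule.map (conjC V) (W.restrictScalars ℚ) = ⊤)
    (hzero : ∀ τ : F₀ →+* ℂ, W ⊓ eigenspaceC F₀ V τ = ⊥ ∨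
      W ⊓ eigenspaceC F₀ V (τ.comp (σ : F₀ →ₐ[ℚ] F₀).toRingHom) = ⊥) :
    (W = ⨆ τ ∈ {τ : F₀ →+* ℂ | eigenspaceC F₀ V τ ≤ W}, eigenspaceC F₀ V τ) ∧
    (∀ g : V →ₗ[F₀] V, ∀ w ∈ W, (g.restrictScalars ℚ).baseChange ℂ w ∈ W) := by
  obtain ⟨P, hsum, hmem, hkill, hpres⟩ := exists_eigenspaceC_projectors F₀ V
  have hdecomp : ∀ v, v = ∑ τ, P τ v := fun v => by
    rw [← LinearMap.sum_apply, hsum, Module.End.one_apply]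
  have hdich : ∀ τ, W ⊓ eigenspaceC F₀ V τ ≠ ⊥ → eigenspaceC F₀ V τ ≤ W := by
    intro τ hτ v hv
    have hτσ := (hzero τ).resolve_left hτ
    have hv' : v ∈ W.restrictScalars ℚ ⊔ Submodule.map (conjC V) (W.restrictScalars ℚ) :=
      hsup ▸ Submodule.mem_top
    obtain ⟨w, hw, _, ⟨w', hw', rfl⟩, hadd⟩ := Submodule.mem_sup.mp hv'
    have hconj : P τ (conjC V w') = 0 := by
      rw [hdecomp w', map_sum, map_sum]
      refine Finset.sum_eq_zero fun ρ _ => ?_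
      by_cases hρ : ρ = τ.comp (σ : F₀ →ₐ[ℚ] F₀).toRingHom
      · have h0 : P ρ w' ∈ W ⊓ eigenspaceC F₀ V (τ.comp (σ : F₀ →ₐ[ℚ] F₀).toRingHom) :=
          ⟨hpres W hstable ρ w' hw', hρ ▸ hmem ρ w'⟩
        rw [hτσ, Submodule.mem_bot] at h0
        rw [h0, map_zero, map_zero]
      · refine hkill τ (ρ.comp (σ : F₀ →ₐ[ℚ] F₀).toRingHom) ?_ _
          (conjC_mem_eigenspaceC (fun a => hσ ρ a) (hmem ρ w'))
        rintro rfl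
        apply hρ
        ext a
        change ρ a = ρ (σ (σ a))
        rw [hσ, hσ, Complex.conj_conj]
    have hself : P τ v = v := by
      conv_rhs => rw [hdecomp v]
      exact (Finset.sum_eq_single τ (fun ρ _ hρ => hkill ρ τ hρ v hv) (by simp)).symm
    rw [← hself, ← hadd, map_add, hconj, add_zero]
    exact hpres W hstable τ w hw
  have hW : W = ⨆ τ ∈ {τ : F₀ →+* ℂ | eigenspaceC F₀ V τ ≤ W}, eigenspaceC F₀ V τ := by
    refine le_antisymm (fun w hw => ?_) (iSup₂_le fun τ hτ => hτ)
    rw [hdecomp w]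
    refine Submodule.sum_mem _ fun τ _ => ?_
    have h0 : P τ w ∈ W ⊓ eigenspaceC F₀ V τ := ⟨hpres W hstable τ w hw, hmem τ w⟩
    by_cases hτ : W ⊓ eigenspaceC F₀ V τ = ⊥
    · rw [hτ, Submodule.mem_bot] at h0
      rw [h0]
      exact Submodule.zero_mem _
    · exact Submodule.mem_iSup_of_mem τ (Submodule.mem_iSup_of_mem (hdich τ hτ) h0.2)
  refine ⟨hW, fun g => ?_⟩
  suffices h : W ≤ W.comap ((g.restrictScalars ℚ).baseChange ℂ) from h
  conv_lhs => rw [hW]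
  exact iSup₂_le fun τ hτ v hv => hτ (baseChange_mem_eigenspaceC g hv)
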